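/- The Werner–Holevo channel in dimension 3 is not catalytic: there do not exist an ancilla dimension m ≥ 1, a unitary V on ℂ^3 ⊗ ℂ^m and a density matrix σ on ℂ^m such that for every density matrix ρ on ℂ^3 both Tr_z[V(ρ ⊗ σ)V†] = (Tr[ρ]·I − ρ^T)/2 and Tr_t[V(ρ ⊗ σ)V†] = σ. Hence there exist unital channels which are not catalytic. -/

import Mathlib

open scoped ComplexOrder Kronecker
open Matrix

/-- A density matrix: positive semidefinite with trace one. -/
def IsDensityMatrix {d : ℕ} (ρ : Matrix (Fin d) (Fin d) ℂ) : Prop :=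
  ρ.PosSemidef ∧ ρ.trace = 1

/-- Partial trace over the second (catalyst) tensor factor. -/
noncomputable def ptraceZ {a b : ℕ} (M : Matrix (Fin a × Fin b) (Fin a × Fin b) ℂ) :
    Matrix (Fin a) (Fin a) ℂ :=
  Matrix.of fun i j => ∑ k, M (i, k) (j, k)

/-- Partial trace over the first (target) tensor factor. -/
noncomputable def ptraceT {a b : ℕ} (M : Matrix (Fin a × Fin b) (Fin a × Fin b) ℂ) :
    Matrix (Fin b) (Fin b) ℂ :=
  Matrix.of fun i j => ∑ k, M (k, i) (k, j)

/-- The Werner–Holevo channel in dimension 3: `ρ ↦ (Tr[ρ]·I - ρᵀ)/2`. -/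
noncomputable def wernerHolevo (ρ : Matrix (Fin 3) (Fin 3) ℂ) : Matrix (Fin 3) (Fin 3) ℂ :=
  (2 : ℂ)⁻¹ • (ρ.trace • (1 : Matrix (Fin 3) (Fin 3) ℂ) - ρ.transpose)

/-- The `(i, j)` block, acting on the second tensor factor, of a bipartite matrix. -/
def tensorBlock {a b : ℕ} (M : Matrix (Fin a × Fin b) (Fin a × Fin b) ℂ) (i j : Fin a) :
    Matrix (Fin b) (Fin b) ℂ :=
  Matrix.of fun k l => M (i, k) (j, l)

section tensorBlock

variable {a b : ℕ}

lemma tensorBlock_mul (M N : Matrix (Fin a × Fin b) (Fin a × Fin b) ℂ) (i j : Fin a) :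
    tensorBlock (M * N) i j = ∑ k, tensorBlock M i k * tensorBlock N k j := by
  ext p q
  simp [tensorBlock, Matrix.mul_apply, Fintype.sum_prod_type, Matrix.sum_apply]

lemma tensorBlock_conjTranspose (M : Matrix (Fin a × Fin b) (Fin a × Fin b) ℂ) (i j : Fin a) :
    tensorBlock Mᴴ i j = (tensorBlock M j i)ᴴ := by
  ext p q
  simp [tensorBlock]

lemma tensorBlock_kronecker (ρ : Matrix (Fin a) (Fin a) ℂ) (σ : Matrix (Fin b) (Fin b) ℂ)
    (i j : Fin a) : tensorBlock (ρ ⊗ₖ σ) i j = ρ i j • σ := by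
  ext p q
  simp [tensorBlock]

lemma ptraceZ_apply (M : Matrix (Fin a × Fin b) (Fin a × Fin b) ℂ) (i j : Fin a) :
    ptraceZ M i j = (tensorBlock M i j).trace := by
  simp [ptraceZ, tensorBlock, Matrix.trace]

lemma ptraceT_eq_sum (M : Matrix (Fin a × Fin b) (Fin a × Fin b) ℂ) :
    ptraceT M = ∑ k, tensorBlock M k k := by
  ext p q
  simp [ptraceT, tensorBlock, Matrix.sum_apply]

lemma ptraceZ_smul (c : ℂ) (M : Matrix (Fin a × Fin b) (Fin a × Fin b) ℂ) :
    ptraceZ (c • M) = c • ptraceZ M := by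
  ext p q
  simp [ptraceZ, Finset.mul_sum]

lemma ptraceT_smul (c : ℂ) (M : Matrix (Fin a × Fin b) (Fin a × Fin b) ℂ) :
    ptraceT (c • M) = c • ptraceT M := by
  ext p q
  simp [ptraceT, Finset.mul_sum]

lemma trace_eq_sum_tensorBlock (M : Matrix (Fin a × Fin b) (Fin a × Fin b) ℂ) :
    M.trace = ∑ k, (tensorBlock M k k).trace := by
  simp [tensorBlock, Matrix.trace, Fintype.sum_prod_type]

lemma trace_mul_one_kronecker (M : Matrix (Fin a × Fin b) (Fin a × Fin b) ℂ)
    (σ : Matrix (Fin b) (Fin b) ℂ) :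
    (M * ((1 : Matrix (Fin a) (Fin a) ℂ) ⊗ₖ σ)).trace = (ptraceT M * σ).trace := by
  simp [trace_eq_sum_tensorBlock, tensorBlock_mul, tensorBlock_kronecker, ptraceT_eq_sum,
    Matrix.one_apply, Finset.sum_mul, Matrix.trace_sum]

end tensorBlock

/-- A unitary conjugate of `1 ⊗ σ` with the same marginal on the second factor is `1 ⊗ σ`. -/
lemma unitary_conj_one_kronecker_eq {a b : ℕ} {V : Matrix (Fin a × Fin b) (Fin a × Fin b) ℂ}
    {σ : Matrix (Fin b) (Fin b) ℂ} (hV : Vᴴ * V = 1) (hσ : σᴴ = σ)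
    (h : ptraceT (V * ((1 : Matrix (Fin a) (Fin a) ℂ) ⊗ₖ σ) * Vᴴ) = (a : ℂ) • σ) :
    V * ((1 : Matrix (Fin a) (Fin a) ℂ) ⊗ₖ σ) * Vᴴ = (1 : Matrix (Fin a) (Fin a) ℂ) ⊗ₖ σ := by
  have hS : ptraceT ((1 : Matrix (Fin a) (Fin a) ℂ) ⊗ₖ σ) = (a : ℂ) • σ := by
    ext p q
    simp [ptraceT]
  have hSs : ((1 : Matrix (Fin a) (Fin a) ℂ) ⊗ₖ σ)ᴴ = (1 : Matrix (Fin a) (Fin a) ℂ) ⊗ₖ σ := by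
    rw [conjTranspose_kronecker, conjTranspose_one, hσ]
  have hMS := trace_mul_one_kronecker (V * ((1 : Matrix (Fin a) (Fin a) ℂ) ⊗ₖ σ) * Vᴴ) σ
  have hSS := trace_mul_one_kronecker ((1 : Matrix (Fin a) (Fin a) ℂ) ⊗ₖ σ) σ
  rw [h] at hMS
  rw [hS, ← hMS] at hSS
  generalize (1 : Matrix (Fin a) (Fin a) ℂ) ⊗ₖ σ = S at *
  have hMs : (V * S * Vᴴ)ᴴ = V * S * Vᴴ := by
    simp [conjTranspose_mul, hSs, Matrix.mul_assoc]
  have hMM : ((V * S * Vᴴ) * (V * S * Vᴴ)).trace = (S * S).trace := by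
    have : (V * S * Vᴴ) * (V * S * Vᴴ) = V * (S * S) * Vᴴ := by
      calc _ = V * S * (Vᴴ * V) * S * Vᴴ := by noncomm_ring
        _ = _ := by rw [hV]; noncomm_ring
    rw [this, Matrix.trace_mul_cycle, hV, Matrix.one_mul]
  have hSM : (S * (V * S * Vᴴ)).trace = (S * S).trace := by rw [Matrix.trace_mul_comm, hSS]
  rw [← sub_eq_zero, ← trace_conjTranspose_mul_self_eq_zero_iff, conjTranspose_sub, hMs, hSs,
    Matrix.sub_mul, Matrix.mul_sub, Matrix.mul_sub]
  simp only [trace_sub, hMM, hSM, ← hSS]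
  ring

open scoped MatrixOrder Matrix.Norms.L2Operator in
/-- A positive semidefinite `σ` is annihilated by any `Y` with `Tr (Y σ Yᴴ) = 0`. -/
lemma mul_eq_zero_of_trace_conj_eq_zero {n : Type*} [Fintype n] [DecidableEq n]
    {σ Y : Matrix n n ℂ} (hσ : σ.PosSemidef) (h : (Y * σ * Yᴴ).trace = 0) : Y * σ = 0 := by
  obtain ⟨B, rfl⟩ := CStarAlgebra.nonneg_iff_eq_star_mul_self.mp hσ.nonneg
  rw [star_eq_conjTranspose] at *
  have hB : B * Yᴴ = 0 := by
    rw [← trace_conjTranspose_mul_self_eq_zero_iff, ← h, conjTranspose_mul,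
      conjTranspose_conjTranspose]
    simp only [Matrix.mul_assoc]
  have hB' : Y * Bᴴ = 0 := by simpa using congrArg conjTranspose hB
  rw [← Matrix.mul_assoc, hB', Matrix.zero_mul]

/-- If `V` and `σ` implement the Werner–Holevo channel on the pure state along `x`, then the
quadratic form of the blocks of `V` at `x` annihilates `σ`. -/
lemma sum_tensorBlock_mul_eq_zero {m : ℕ} {V : Matrix (Fin 3 × Fin m) (Fin 3 × Fin m) ℂ}
    {σ : Matrix (Fin m) (Fin m) ℂ} (hσ : σ.PosSemidef)
    (h : ∀ ρ, IsDensityMatrix ρ → ptraceZ (V * (ρ ⊗ₖ σ) * Vᴴ) = wernerHolevo ρ)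
    {x : Fin 3 → ℂ} (hx : x ≠ 0) :
    ∑ i, ∑ j, (x i * x j) • (tensorBlock V i j * σ) = 0 := by
  have hpsd : (vecMulVec x (star x)).PosSemidef := posSemidef_vecMulVec_self_star x
  have hpos : 0 < x ⬝ᵥ star x := dotProduct_self_star_pos_iff.mpr hx
  have hρ : IsDensityMatrix ((x ⬝ᵥ star x)⁻¹ • vecMulVec x (star x)) :=
    ⟨hpsd.smul (inv_nonneg.mpr hpos.le), by
      rw [trace_smul, trace_vecMulVec, smul_eq_mul, inv_mul_cancel₀ hpos.ne']⟩
  have hZ := h _ hρ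
  rw [smul_kronecker, Matrix.mul_smul, Matrix.smul_mul, ptraceZ_smul] at hZ
  have hZ' : ptraceZ (V * (vecMulVec x (star x) ⊗ₖ σ) * Vᴴ) =
      wernerHolevo (vecMulVec x (star x)) := by
    apply smul_right_injective _ (inv_ne_zero hpos.ne')
    refine hZ.trans ?_
    simp only [wernerHolevo, trace_smul, transpose_smul, smul_assoc, ← smul_sub]
    rw [smul_comm]
  have hY : ∑ i, ∑ j, (x i * x j) • (tensorBlock V i j * σ) =
      (∑ i, ∑ j, (x i * x j) • tensorBlock V i j) * σ := by
    simp only [Finset.sum_mul, Matrix.smul_mul]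
  rw [hY]
  refine mul_eq_zero_of_trace_conj_eq_zero hσ ?_
  have hsum : ((∑ i, ∑ j, (x i * x j) • tensorBlock V i j) * σ *
      (∑ i, ∑ j, (x i * x j) • tensorBlock V i j)ᴴ).trace =
      ∑ p, ∑ q, x p * star (x q) * ptraceZ (V * (vecMulVec x (star x) ⊗ₖ σ) * Vᴴ) p q := by
    simp only [ptraceZ_apply, tensorBlock_mul, tensorBlock_kronecker, tensorBlock_conjTranspose,
      vecMulVec_apply, Fin.sum_univ_three, conjTranspose_add, conjTranspose_smul, Matrix.add_mul,
      Matrix.mul_add, Matrix.smul_mul, Matrix.mul_smul, trace_add, trace_smul, smul_eq_mul,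
      Pi.star_apply, star_mul]
    ring
  rw [hsum, hZ']
  simp [wernerHolevo, Fin.sum_univ_three, vecMulVec_apply, trace_vecMulVec, dotProduct,
    Matrix.one_apply]
  ring

/-- A block antisymmetric `3 × 3` block matrix `W` with `Wᴴ W = W Wᴴ = 1 ⊗ τ` forces
`τ * τ = 0`. -/
lemma mul_self_eq_zero_of_tensorBlock_antisymm {m : ℕ}
    {W : Matrix (Fin 3 × Fin m) (Fin 3 × Fin m) ℂ} {τ : Matrix (Fin m) (Fin m) ℂ}
    (hanti : ∀ i j, tensorBlock W j i = -tensorBlock W i j)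
    (hdiag : ∀ i, tensorBlock W i i = 0)
    (h₁ : Wᴴ * W = (1 : Matrix (Fin 3) (Fin 3) ℂ) ⊗ₖ τ)
    (h₂ : W * Wᴴ = (1 : Matrix (Fin 3) (Fin 3) ℂ) ⊗ₖ τ) : τ * τ = 0 := by
  have row (i : Fin 3) : ∑ k, tensorBlock W i k * (tensorBlock W i k)ᴴ = τ := by
    simpa [tensorBlock_mul, tensorBlock_conjTranspose, tensorBlock_kronecker] using
      congrArg (tensorBlock · i i) h₂
  have col : ∑ k, (tensorBlock W k 0)ᴴ * tensorBlock W k 1 = 0 := by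
    simpa [tensorBlock_mul, tensorBlock_conjTranspose, tensorBlock_kronecker] using
      congrArg (tensorBlock · 0 1) h₁
  have r0 := row 0
  have r1 := row 1
  have r2 := row 2
  simp only [Fin.sum_univ_three, hdiag, hanti 0 1, hanti 0 2, hanti 1 2, conjTranspose_neg,
    conjTranspose_zero, neg_mul_neg, Matrix.zero_mul, Matrix.mul_zero, zero_add, add_zero]
    at r0 r1 r2 col
  generalize tensorBlock W 0 1 = c at *
  generalize tensorBlock W 0 2 = b at *
  generalize tensorBlock W 1 2 = a at *
  have hb : τ = (2 : ℂ) • (b * bᴴ) := by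
    have : τ = τ + τ - τ := by abel
    rw [this]
    nth_rewrite 1 [← r0]
    nth_rewrite 1 [← r2]
    rw [← r1, two_smul]
    abel
  have ha : τ = (2 : ℂ) • (a * aᴴ) := by
    have : τ = τ + τ - τ := by abel
    rw [this]
    nth_rewrite 1 [← r1]
    nth_rewrite 1 [← r2]
    rw [← r0, two_smul]
    abel
  calc τ * τ = ((2 : ℂ) • (b * bᴴ)) * ((2 : ℂ) • (a * aᴴ)) := by rw [← hb, ← ha]
    _ = (4 : ℂ) • (b * (bᴴ * a) * aᴴ) := by
      rw [Matrix.smul_mul, Matrix.mul_smul, smul_smul]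
      norm_num [Matrix.mul_assoc]
    _ = 0 := by simp [col]

/-- The Werner–Holevo channel in dimension 3 is not catalytic: no unitary `V`
and catalyst state `σ` implement it on every density matrix while returning the
catalyst unchanged.  Hence there exist unital channels which are not catalytic. -/
theorem wernerHolevo_not_catalytic :
    ¬ ∃ (m : ℕ) (V : Matrix (Fin 3 × Fin m) (Fin 3 × Fin m) ℂ)
        (σ : Matrix (Fin m) (Fin m) ℂ),
      1 ≤ m ∧ V ∈ Matrix.unitaryGroup (Fin 3 × Fin m) ℂ ∧ IsDensityMatrix σ ∧
        ∀ ρ : Matrix (Fin 3) (Fin 3) ℂ, IsDensityMatrix ρ →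
          ptraceZ (V * (ρ ⊗ₖ σ) * Vᴴ) = wernerHolevo ρ ∧
          ptraceT (V * (ρ ⊗ₖ σ) * Vᴴ) = σ := by
  rintro ⟨m, V, σ, -, hV, ⟨hσ, htr⟩, h⟩
  have hVV : Vᴴ * V = 1 := Matrix.mem_unitaryGroup_iff'.mp hV
  have hσs : σᴴ = σ := hσ.isHermitian
  have hρ : IsDensityMatrix ((3 : ℂ)⁻¹ • (1 : Matrix (Fin 3) (Fin 3) ℂ)) :=
    ⟨PosSemidef.one.smul (by positivity), by simp⟩
  have hT := (h _ hρ).2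
  rw [smul_kronecker, Matrix.mul_smul, Matrix.smul_mul, ptraceT_smul,
    inv_smul_eq_iff₀ (by norm_num)] at hT
  have hcomm := unitary_conj_one_kronecker_eq hVV hσs (by exact_mod_cast hT)
  have hquad (x : Fin 3 → ℂ) (hx : x ≠ 0) :=
    sum_tensorBlock_mul_eq_zero hσ (fun ρ hρ => (h ρ hρ).1) hx
  have hdiag (i : Fin 3) : tensorBlock V i i * σ = 0 := by
    simpa [Pi.single_apply] using hquad (Pi.single i 1) (by simp)
  have hanti (i j : Fin 3) : tensorBlock V j i * σ = -(tensorBlock V i j * σ) := by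
    rcases eq_or_ne i j with rfl | hij
    · simp [hdiag]
    · have := hquad (Pi.single i 1 + Pi.single j 1) fun h0 => by
        simpa [hij] using congrFun h0 i
      simp [Pi.single_apply, mul_add, add_smul, Finset.sum_add_distrib, hdiag] at this
      exact eq_neg_of_add_eq_zero_left this
  have hblock (i j : Fin 3) :
      tensorBlock (V * ((1 : Matrix (Fin 3) (Fin 3) ℂ) ⊗ₖ σ)) i j = tensorBlock V i j * σ := by
    simp [tensorBlock_mul, tensorBlock_kronecker, Matrix.one_apply]
  have hSs : ((1 : Matrix (Fin 3) (Fin 3) ℂ) ⊗ₖ σ)ᴴ = (1 : Matrix (Fin 3) (Fin 3) ℂ) ⊗ₖ σ := by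
    rw [conjTranspose_kronecker, conjTranspose_one, hσs]
  have hSS : ((1 : Matrix (Fin 3) (Fin 3) ℂ) ⊗ₖ σ) * ((1 : Matrix (Fin 3) (Fin 3) ℂ) ⊗ₖ σ) =
      (1 : Matrix (Fin 3) (Fin 3) ℂ) ⊗ₖ (σ * σ) := by
    rw [← mul_kronecker_mul, Matrix.one_mul]
  have hsq : (σ * σ) * (σ * σ) = 0 := by
    refine mul_self_eq_zero_of_tensorBlock_antisymm
      (W := V * ((1 : Matrix (Fin 3) (Fin 3) ℂ) ⊗ₖ σ))
      (fun i j => by simp only [hblock, hanti i j]) (fun i => by rw [hblock, hdiag]) ?_ ?_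
    · rw [← hSS, conjTranspose_mul, hSs]
      generalize (1 : Matrix (Fin 3) (Fin 3) ℂ) ⊗ₖ σ = S at *
      rw [Matrix.mul_assoc, ← Matrix.mul_assoc Vᴴ, hVV, Matrix.one_mul]
    · rw [← hSS, conjTranspose_mul, hSs]
      generalize (1 : Matrix (Fin 3) (Fin 3) ℂ) ⊗ₖ σ = S at *
      calc V * S * (S * Vᴴ) = V * S * (Vᴴ * V) * (S * Vᴴ) := by rw [hVV, Matrix.mul_one]
        _ = (V * S * Vᴴ) * (V * S * Vᴴ) := by simp only [Matrix.mul_assoc]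
        _ = S * S := by rw [hcomm]
  have hsq' : σ * σ = 0 := by
    rw [← conjTranspose_mul_self_eq_zero, conjTranspose_mul, hσs, hsq]
  have hzero : σ = 0 := by
    rw [← conjTranspose_mul_self_eq_zero, hσs, hsq']
  simp [hzero] at htr
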